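/- arXiv:2305.05123 — 2 statements merged into one kernel-verified Lean document; each statement's English description precedes it below -/
import Mathlib

section
/- Let {e_α : α ∈ J} be an orthonormal basis of the complex Hilbert space H and let Φ be the associated map on P(H). Then Φ is nonexpansive: ‖Φ(P) − Φ(Q)‖ ≤ ‖P − Q‖ for all P, Q ∈ P(H). -/
open scoped InnerProductSpace ComplexConjugate

variable {H : Type*} [NormedAddCommGroup H] [InnerProductSpace ℂ H] [CompleteSpace H]

/-- The rank-one (orthogonal) projection onto the span of a unit vector `v`,
i.e. `x ↦ ⟪v, x⟫ • v`. -/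
noncomputable def rankOneProj (v : H) : H →L[ℂ] H :=
  (innerSL ℂ v).smulRight v

/-- A rank-one projection: a self-adjoint idempotent bounded operator with
one-dimensional range. -/
def IsRankOneProjection (P : H →L[ℂ] H) : Prop :=
  IsSelfAdjoint P ∧ P ∘L P = P ∧ Module.finrank ℂ (LinearMap.range (P : H →ₗ[ℂ] H)) = 1

/-- Given a Hilbert basis `b = {e_α}` and a vector `v = Σ c_α e_α`, the associated vector
`Σ |c_α| e_α`.  The map `Φ` associated with `b` sends the rank-one projection onto `ℂ v`
(for a unit vector `v`) to the rank-one projection onto `ℂ (absVec b v)`. -/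
noncomputable def absVec {ι : Type*} (b : HilbertBasis ι ℂ H) (v : H) : H :=
  b.repr.symm ⟨fun α => (‖b.repr v α‖ : ℂ), by
    apply memℓp_gen
    have h := ((b.repr v).property).summable
      (by norm_num : (0 : ℝ) < (2 : ENNReal).toReal)
    refine h.congr fun α => ?_
    simp [Complex.norm_real]⟩

set_option linter.unusedSectionVars false

theorem rankOneProj_apply (v x : H) : rankOneProj v x = ⟪v, x⟫_ℂ • v := rfl

theorem norm_smul_sub_smul_sq_of_inner_eq_zero (p q : ℂ) {v u : H} (h : ⟪v, u⟫_ℂ = 0) :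
    ‖p • v - q • u‖ ^ 2 = ‖p‖ ^ 2 * ‖v‖ ^ 2 + ‖q‖ ^ 2 * ‖u‖ ^ 2 := by
  rw [@norm_sub_sq ℂ, inner_smul_left, inner_smul_right, h, norm_smul, norm_smul]
  simp [mul_pow]

theorem norm_sub_inner_smul_sq {v : H} (hv : ‖v‖ = 1) (x : H) :
    ‖x - ⟪v, x⟫_ℂ • v‖ ^ 2 = ‖x‖ ^ 2 - ‖⟪v, x⟫_ℂ‖ ^ 2 := by
  rw [@norm_sub_sq ℂ, inner_smul_right, ← inner_conj_symm x v, norm_smul, hv, RCLike.mul_conj,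
    mul_one, ← RCLike.ofReal_pow, RCLike.ofReal_re]
  ring

theorem inner_sub_inner_smul_self {v : H} (hv : ‖v‖ = 1) (x : H) :
    ⟪v, x - ⟪v, x⟫_ℂ • v⟫_ℂ = 0 := by
  simp [inner_self_eq_norm_sq_to_K, hv]

theorem norm_rankOneProj_sub_apply_sq_le {v w : H} (hv : ‖v‖ = 1) (hw : ‖w‖ = 1) (x : H) :
    ‖(rankOneProj v - rankOneProj w) x‖ ^ 2 ≤ (1 - ‖⟪v, w⟫_ℂ‖ ^ 2) * ‖x‖ ^ 2 := by
  have hvu := inner_sub_inner_smul_self hv w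
  have hu := norm_sub_inner_smul_sq hv w
  have hx := norm_sub_inner_smul_sq hv x
  set g := ⟪v, w⟫_ℂ with hg
  set a := ⟪v, x⟫_ℂ with ha
  set u := w - g • v with hudef
  set d := ⟪u, x⟫_ℂ with hd
  have hwu : w = g • v + u := by simp [hudef]
  have hb : ⟪w, x⟫_ℂ = conj g * a + d := by
    rw [hwu, inner_add_left, inner_smul_left]
  have hTx : (rankOneProj v - rankOneProj w) x =
      (a - (conj g * a + d) * g) • v - (conj g * a + d) • u := by
    rw [sub_apply, rankOneProj_apply, rankOneProj_apply, hb]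
    nth_rewrite 1 [hwu]
    module
  have hdx : d = ⟪u, x - a • v⟫_ℂ := by
    rw [inner_sub_right, inner_smul_right, inner_eq_zero_symm.mp hvu]
    simp [hd]
  have hcs : ‖d‖ ^ 2 ≤ (1 - ‖g‖ ^ 2) * (‖x‖ ^ 2 - ‖a‖ ^ 2) := by
    have h := norm_inner_le_norm (𝕜 := ℂ) u (x - a • v)
    rw [← hdx] at h
    calc ‖d‖ ^ 2 ≤ (‖u‖ * ‖x - a • v‖) ^ 2 := by gcongr
      _ = _ := by rw [mul_pow, hu, hx, hw, one_pow]
  have key : ‖a - (conj g * a + d) * g‖ ^ 2 + ‖conj g * a + d‖ ^ 2 * (1 - ‖g‖ ^ 2) =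
      (1 - ‖g‖ ^ 2) * ‖a‖ ^ 2 + ‖d‖ ^ 2 := by
    simp only [Complex.sq_norm, Complex.normSq_apply, Complex.sub_re, Complex.sub_im,
      Complex.add_re, Complex.add_im, Complex.mul_re, Complex.mul_im, Complex.conj_re,
      Complex.conj_im]
    ring
  rw [hTx, norm_smul_sub_smul_sq_of_inner_eq_zero _ _ hvu, hu, hv, hw]
  linarith

theorem norm_rankOneProj_sub_sq {v w : H} (hv : ‖v‖ = 1) (hw : ‖w‖ = 1) :
    ‖rankOneProj v - rankOneProj w‖ ^ 2 = 1 - ‖⟪v, w⟫_ℂ‖ ^ 2 := by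
  have hnonneg : 0 ≤ 1 - ‖⟪v, w⟫_ℂ‖ ^ 2 := by
    have h := norm_sub_inner_smul_sq hv w
    rw [hw, one_pow] at h
    exact h ▸ sq_nonneg _
  apply le_antisymm
  · rw [← Real.le_sqrt (norm_nonneg _) hnonneg]
    refine ContinuousLinearMap.opNorm_le_bound _ (Real.sqrt_nonneg _) fun x => ?_
    refine le_of_sq_le_sq ?_ (by positivity)
    rw [mul_pow, Real.sq_sqrt hnonneg]
    exact norm_rankOneProj_sub_apply_sq_le hv hw x
  · have h := (rankOneProj v - rankOneProj w).le_opNorm v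
    have hTv : (rankOneProj v - rankOneProj w) v = v - ⟪w, v⟫_ℂ • w := by
      simp [rankOneProj_apply, inner_self_eq_norm_sq_to_K, hv]
    rw [hTv, hv, mul_one] at h
    have hsq := norm_sub_inner_smul_sq hw v
    rw [hv, one_pow, norm_inner_symm] at hsq
    rw [← hsq]
    gcongr

theorem repr_absVec {ι : Type*} (b : HilbertBasis ι ℂ H) (v : H) (i : ι) :
    b.repr (absVec b v) i = (‖b.repr v i‖ : ℂ) := by
  simp [absVec]

theorem inner_absVec {ι : Type*} (b : HilbertBasis ι ℂ H) (v w : H) :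
    ⟪absVec b v, absVec b w⟫_ℂ = ((∑' i, ‖b.repr v i‖ * ‖b.repr w i‖ : ℝ) : ℂ) := by
  rw [← b.repr.inner_map_map, lp.inner_eq_tsum, Complex.ofReal_tsum]
  refine tsum_congr fun i => ?_
  simp [repr_absVec, mul_comm]

theorem norm_absVec {ι : Type*} (b : HilbertBasis ι ℂ H) (v : H) : ‖absVec b v‖ = ‖v‖ := by
  rw [← b.repr.norm_map, ← b.repr.norm_map v, lp.norm_eq_tsum_rpow (by norm_num),
    lp.norm_eq_tsum_rpow (by norm_num)]
  simp [repr_absVec]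

theorem norm_inner_le_norm_inner_absVec {ι : Type*} (b : HilbertBasis ι ℂ H) (v w : H) :
    ‖⟪v, w⟫_ℂ‖ ≤ ‖⟪absVec b v, absVec b w⟫_ℂ‖ := by
  have hterm (i : ι) : ‖⟪v, b i⟫_ℂ * ⟪b i, w⟫_ℂ‖ = ‖b.repr v i‖ * ‖b.repr w i‖ := by
    rw [norm_mul, b.repr_apply_apply, b.repr_apply_apply, norm_inner_symm]
  rw [inner_absVec, Complex.norm_real, ← b.tsum_inner_mul_inner v w]
  refine (norm_tsum_le_tsum_norm (b.summable_inner_mul_inner v w).norm).trans ?_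
  rw [tsum_congr hterm]
  exact Real.le_norm_self _

/-- For any orthonormal basis `{e_α}` of `H`, the associated map `Φ` on the
set of rank-one projections is nonexpansive:  `‖Φ(P) − Φ(Q)‖ ≤ ‖P − Q‖` for all rank-one
projections `P, Q` (written here for `P, Q` the projections onto the spans of arbitrary unit
vectors `v, w`). -/
theorem absVec_proj_nonexpansive {ι : Type*} (b : HilbertBasis ι ℂ H)
    (v w : H) (hv : ‖v‖ = 1) (hw : ‖w‖ = 1) :
    ‖rankOneProj (absVec b v) - rankOneProj (absVec b w)‖ ≤
      ‖rankOneProj v - rankOneProj w‖ := by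
  refine le_of_sq_le_sq ?_ (norm_nonneg _)
  rw [norm_rankOneProj_sub_sq hv hw,
    norm_rankOneProj_sub_sq ((norm_absVec b v).trans hv) ((norm_absVec b w).trans hw)]
  gcongr
  exact norm_inner_le_norm_inner_absVec b v w
end

section
/- Let v and w be unit vectors in a complex Hilbert space H, and let P_v and P_w be the rank-one projections onto ℂv and ℂw respectively. Then ‖P_v − P_w‖ = √(1 − |⟨v, w⟩|²), where ‖·‖ is the operator norm. -/
open scoped InnerProductSpace ComplexConjugate

variable {H : Type*} [NormedAddCommGroup H] [InnerProductSpace ℂ H] [CompleteSpace H]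

theorem isSelfAdjoint_rankOneProj (v : H) : IsSelfAdjoint (rankOneProj v) := by
  rw [ContinuousLinearMap.isSelfAdjoint_iff_isSymmetric]
  intro x y
  simp only [rankOneProj, ContinuousLinearMap.coe_coe, ContinuousLinearMap.smulRight_apply,
    innerSL_apply_apply, inner_smul_left, inner_smul_right, inner_conj_symm]
  ring

theorem rankOneProj_sub_rankOneProj_pow_three {E : Type*} [NormedAddCommGroup E]
    [InnerProductSpace ℂ E] {v w : E} (hv : ‖v‖ = 1) (hw : ‖w‖ = 1) :
    (rankOneProj v - rankOneProj w) * ((rankOneProj v - rankOneProj w) *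
      (rankOneProj v - rankOneProj w)) =
      ((1 - ‖⟪v, w⟫_ℂ‖ ^ 2 : ℝ) : ℂ) • (rankOneProj v - rankOneProj w) := by
  have hvv : ⟪v, v⟫_ℂ = 1 := by simp [inner_self_eq_norm_sq_to_K, hv]
  have hww : ⟪w, w⟫_ℂ = 1 := by simp [inner_self_eq_norm_sq_to_K, hw]
  have hs : ((1 - ‖⟪v, w⟫_ℂ‖ ^ 2 : ℝ) : ℂ) = 1 - ⟪v, w⟫_ℂ * ⟪w, v⟫_ℂ := by
    rw [← inner_conj_symm w v, Complex.mul_conj']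
    push_cast
    rfl
  rw [hs]
  ext x
  simp only [rankOneProj, mul_apply_eq_comp, sub_apply, smul_apply,
    ContinuousLinearMap.smulRight_apply, innerSL_apply_apply, inner_sub_right, inner_smul_right, hvv, hww]
  module

/-- Lemma 2.2. For unit vectors `v, w` in a complex Hilbert space of
dimension at least 2, the rank-one projections onto `ℂv` and `ℂw` satisfy
`‖P_v − P_w‖ = √(1 − |⟪v, w⟫|²)`, where `‖·‖` is the operator norm. -/
theorem norm_rankOneProj_sub_rankOneProj
    (hdim : 2 ≤ Module.rank ℂ H)
    (v w : H) (hv : ‖v‖ = 1) (hw : ‖w‖ = 1) :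
    ‖rankOneProj v - rankOneProj w‖ = Real.sqrt (1 - ‖⟪v, w⟫_ℂ‖ ^ 2) := by
  set s : ℝ := 1 - ‖⟪v, w⟫_ℂ‖ ^ 2 with hs_def
  set A := rankOneProj v - rankOneProj w with hA
  have hA_self : IsSelfAdjoint A :=
    (isSelfAdjoint_rankOneProj v).sub (isSelfAdjoint_rankOneProj w)
  have hs : 0 ≤ s := by
    have h := norm_inner_le_norm (𝕜 := ℂ) v w
    rw [hv, hw, mul_one] at h
    nlinarith [norm_nonneg ⟪v, w⟫_ℂ]
  have hA_cube : A * (A * A) = (s : ℂ) • A := rankOneProj_sub_rankOneProj_pow_three hv hw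
  have hnorm : ‖A * A‖ = ‖A‖ ^ 2 := hA_self.norm_mul_self
  have hnorm_sq : ‖(A * A) * (A * A)‖ = ‖A * A‖ ^ 2 :=
    IsSelfAdjoint.norm_mul_self ((hA_self.commute_iff hA_self).1 (Commute.refl A))
  have hfour : (A * A) * (A * A) = (s : ℂ) • (A * A) := by
    rw [mul_assoc, hA_cube, mul_smul_comm]
  rw [hfour, norm_smul, hnorm, Complex.norm_of_nonneg hs] at hnorm_sq
  by_cases h0 : A = 0
  · have h : ⟪v, A v⟫_ℂ = (s : ℂ) := by
      simp only [hA, rankOneProj, sub_apply,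
        ContinuousLinearMap.smulRight_apply, innerSL_apply_apply, inner_sub_right,
        inner_smul_right, inner_self_eq_norm_sq_to_K, hv, hs_def]
      rw [mul_comm, ← inner_conj_symm w v, Complex.conj_mul']
      simp
    have hs0 : s = 0 := by
      rw [h0, zero_apply, inner_zero_right] at h
      exact_mod_cast h.symm
    simp [h0, hs0]
  · have hpos : 0 < ‖A‖ ^ 2 := by positivity
    rw [eq_comm, Real.sqrt_eq_iff_eq_sq hs (norm_nonneg A)]
    exact mul_right_cancel₀ hpos.ne' (by rw [hnorm_sq]; ring)
end
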